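/- Let 𝒳 be a finite set, x ↦ W_x a pure-state classical–quantum channel on ℂ^d, and P a probability distribution on 𝒳. Then for every ε ∈ (0,1), the hypothesis-testing relative entropy satisfies D_H^ε(R[P] ‖ S[P, W_P]) ≥ H_s^ε(W_P). -/

import Mathlib

open scoped ComplexOrder

/-- Projection onto the sum of eigenspaces of a Hermitian matrix with nonnegative
eigenvalues (junk value `0` if the matrix is not Hermitian). -/
noncomputable def projNonneg {n : Type*} [Fintype n] [DecidableEq n]
    (A : Matrix n n ℂ) : Matrix n n ℂ :=
  if hA : A.IsHermitian then
    (hA.eigenvectorUnitary : Matrix n n ℂ) *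
      Matrix.diagonal (fun i => if 0 ≤ hA.eigenvalues i then (1 : ℂ) else 0) *
      star (hA.eigenvectorUnitary : Matrix n n ℂ)
  else 0

/-- A pure state: a rank-one orthogonal projection, equivalently a Hermitian
idempotent of trace one. -/
def IsPureState {n : Type*} [Fintype n] (ρ : Matrix n n ℂ) : Prop :=
  ρ.IsHermitian ∧ ρ * ρ = ρ ∧ ρ.trace = 1

/-- A state: a positive semidefinite matrix of trace one. -/
def IsState {n : Type*} [Fintype n] (ρ : Matrix n n ℂ) : Prop :=
  ρ.PosSemidef ∧ ρ.trace = 1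

/-- `H_s^ε(ρ) = sup {λ | tr(ρ {ρ ≥ e^{-λ} I}) ≤ ε}`. -/
noncomputable def Hs {n : Type*} [Fintype n] [DecidableEq n]
    (ε : ℝ) (ρ : Matrix n n ℂ) : ℝ :=
  sSup {lam : ℝ |
    ((ρ * projNonneg (ρ - Real.exp (-lam) • (1 : Matrix n n ℂ))).trace).re ≤ ε}

/-- Hypothesis-testing relative entropy
`D_H^ε(ρ‖σ) = −log min{tr(Qσ) : 0 ≤ Q ≤ I, tr(Qρ) ≥ 1−ε}`. -/
noncomputable def DH {n : Type*} [Fintype n] [DecidableEq n]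
    (ε : ℝ) (ρ σ : Matrix n n ℂ) : ℝ :=
  - Real.log (sInf {t : ℝ | ∃ Q : Matrix n n ℂ,
      Q.PosSemidef ∧ ((1 : Matrix n n ℂ) - Q).PosSemidef ∧
      1 - ε ≤ ((Q * ρ).trace).re ∧ t = ((Q * σ).trace).re})

/-- The average state `W_P = Σ_x P(x) W_x`. -/
noncomputable def WPavg {X : Type*} [Fintype X] {n : Type*} [Fintype n]
    (P : X → ℝ) (W : X → Matrix n n ℂ) : Matrix n n ℂ :=
  ∑ x, (P x : ℂ) • W x

/-- The classical-quantum state `R[P] = Σ_x P(x) |x⟩⟨x| ⊗ W_x`. -/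
noncomputable def Rcq {X : Type*} [DecidableEq X] {n : Type*}
    (P : X → ℝ) (W : X → Matrix n n ℂ) : Matrix (X × n) (X × n) ℂ :=
  Matrix.of fun p q => if p.1 = q.1 then (P p.1 : ℂ) * W p.1 p.2 q.2 else 0

/-- The product state `S[P,ρ] = (Σ_x P(x)|x⟩⟨x|) ⊗ ρ`. -/
noncomputable def Scq {X : Type*} [DecidableEq X] {n : Type*}
    (P : X → ℝ) (ρ : Matrix n n ℂ) : Matrix (X × n) (X × n) ℂ :=
  Matrix.of fun p q => if p.1 = q.1 then (P p.1 : ℂ) * ρ p.2 q.2 else 0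

namespace Matrix

variable {n X : Type*}

/-- The block-diagonal matrix with blocks `Q x`, indexed block first. -/
def blockSum [DecidableEq X] (Q : X → Matrix n n ℂ) : Matrix (X × n) (X × n) ℂ :=
  of fun p q => if p.1 = q.1 then Q p.1 p.2 q.2 else 0

lemma one_sub_blockSum [DecidableEq n] [DecidableEq X] (Q : X → Matrix n n ℂ) :
    1 - blockSum Q = blockSum fun x => 1 - Q x := by
  ext p q
  by_cases h : p.1 = q.1
  · by_cases h' : p.2 = q.2 <;> simp [blockSum, one_apply, Prod.ext_iff, h, h']
  · simp [blockSum, one_apply, Prod.ext_iff, h]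

lemma submatrix_blockSum [DecidableEq X] (Q : X → Matrix n n ℂ) (x : X) :
    (blockSum Q).submatrix (Prod.mk x) (Prod.mk x) = Q x := by
  ext i j
  simp [blockSum]

variable [Fintype n]

lemma PosSemidef.of_isHermitian_of_mul_self {A : Matrix n n ℂ} (hA : A.IsHermitian)
    (h : A * A = A) : A.PosSemidef := by
  have := posSemidef_conjTranspose_mul_self A
  rwa [hA.eq, h] at this

lemma PosSemidef.re_trace_nonneg {A : Matrix n n ℂ} (hA : A.PosSemidef) : 0 ≤ A.trace.re :=
  (Complex.nonneg_iff.mp hA.trace_nonneg).1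

lemma PosSemidef.re_trace_mul_nonneg_of_mul_self {A W : Matrix n n ℂ} (hA : A.PosSemidef)
    (hW : W.IsHermitian) (hWW : W * W = W) : 0 ≤ (A * W).trace.re := by
  have h := (hA.mul_mul_conjTranspose_same W).re_trace_nonneg
  rwa [hW.eq, trace_mul_comm, ← mul_assoc, hWW, trace_mul_comm] at h

lemma posSemidef_blockSum [Fintype X] [DecidableEq X] {Q : X → Matrix n n ℂ}
    (hQ : ∀ x, (Q x).PosSemidef) : (blockSum Q).PosSemidef := by
  refine .of_dotProduct_mulVec_nonneg ?_ fun u => ?_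
  · ext p q
    by_cases h : p.1 = q.1
    · simpa [blockSum, h] using (hQ q.1).isHermitian.apply p.2 q.2
    · simp [blockSum, h, Ne.symm h]
  · have key : star u ⬝ᵥ (blockSum Q *ᵥ u) =
        ∑ x, star (fun i => u (x, i)) ⬝ᵥ (Q x *ᵥ fun i => u (x, i)) := by
      simp only [dotProduct, mulVec, blockSum, Fintype.sum_prod_type, of_apply, Pi.star_apply,
        ite_mul, zero_mul]
      refine Finset.sum_congr rfl fun x _ => Finset.sum_congr rfl fun i _ => ?_
      congr 1
      rw [Finset.sum_comm]
      simp
    rw [key]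
    exact Finset.sum_nonneg fun x _ => (hQ x).dotProduct_mulVec_nonneg _

lemma trace_mul_Rcq [Fintype X] [DecidableEq X] (P : X → ℝ) (W : X → Matrix n n ℂ)
    (Q : Matrix (X × n) (X × n) ℂ) :
    (Q * Rcq P W).trace.re =
      ∑ x, P x * (Q.submatrix (Prod.mk x) (Prod.mk x) * W x).trace.re := by
  have key : (Q * Rcq P W).trace =
      ∑ x, (P x : ℂ) * (Q.submatrix (Prod.mk x) (Prod.mk x) * W x).trace := by
    simp only [trace, diag_apply, mul_apply, Rcq, of_apply, Fintype.sum_prod_type, submatrix_apply,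
      Finset.mul_sum]
    refine Finset.sum_congr rfl fun x _ => Finset.sum_congr rfl fun i _ => ?_
    rw [Finset.sum_comm]
    refine Finset.sum_congr rfl fun j _ => ?_
    simp [mul_left_comm]
  simp [key]

lemma trace_mul_Scq [Fintype X] [DecidableEq X] (P : X → ℝ) (ρ : Matrix n n ℂ)
    (Q : Matrix (X × n) (X × n) ℂ) :
    (Q * Scq P ρ).trace.re =
      ∑ x, P x * (Q.submatrix (Prod.mk x) (Prod.mk x) * ρ).trace.re :=
  trace_mul_Rcq P (fun _ => ρ) Q

lemma re_trace_mul_WPavg [Fintype X] (P : X → ℝ) (W : X → Matrix n n ℂ) (Q : Matrix n n ℂ) :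
    (Q * WPavg P W).trace.re = ∑ x, P x * (Q * W x).trace.re := by
  simp [WPavg, Finset.mul_sum, trace_sum]

end Matrix

open Matrix

lemma IsPureState.eq_vecMulVec {n : Type*} [Fintype n] {W : Matrix n n ℂ} (hW : IsPureState W) :
    ∃ (a : ℂ) (v : n → ℂ), W = a • vecMulVec v (star v) := by
  obtain ⟨hH, hI, ht⟩ := hW
  have hne : ∃ j, W j j ≠ 0 := by
    by_contra! h
    simp [trace, h] at ht
  obtain ⟨j, hj⟩ := hne
  set v : n → ℂ := fun i => W i j with hv
  have hstar : ∀ i k, star (W i k) = W k i := fun i k => hH.apply k i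
  have hvv : star v ⬝ᵥ v = W j j := by
    conv_rhs => rw [← hI]
    simp only [dotProduct, Pi.star_apply, hv, hstar, mul_apply]
  have hWv : W * vecMulVec v (star v) = vecMulVec v (star v) := by
    rw [mul_vecMulVec]
    congr 1
    ext i
    conv_rhs => rw [hv, ← hI]
    simp [mulVec, dotProduct, hv, mul_apply]
  have hVH : (vecMulVec v (star v)).IsHermitian := (posSemidef_vecMulVec_self_star v).isHermitian
  have hvW : vecMulVec v (star v) * W = vecMulVec v (star v) := by
    have := congrArg conjTranspose hWv
    rwa [conjTranspose_mul, hVH.eq, hH.eq] at this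
  have hVV : vecMulVec v (star v) * vecMulVec v (star v) = W j j • vecMulVec v (star v) := by
    rw [vecMulVec_mul_vecMulVec, hvv, vecMulVec_smul]
  set V := vecMulVec v (star v) with hV
  have hreal : star (W j j)⁻¹ = (W j j)⁻¹ := by rw [star_inv₀, hstar]
  have hEH : (W - (W j j)⁻¹ • V).IsHermitian := by
    rw [IsHermitian, conjTranspose_sub, conjTranspose_smul, hH.eq, hVH.eq, hreal]
  have hEE : (W - (W j j)⁻¹ • V) * (W - (W j j)⁻¹ • V) = W - (W j j)⁻¹ • V := by
    simp only [mul_sub, sub_mul, Matrix.mul_smul, Matrix.smul_mul, hI, hWv, hvW, hVV, smul_smul]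
    rw [inv_mul_cancel₀ hj, mul_one]
    abel
  have hE : W - (W j j)⁻¹ • V = 0 := by
    rw [← (PosSemidef.of_isHermitian_of_mul_self hEH hEE).trace_eq_zero_iff, trace_sub, ht,
      trace_smul, hV, trace_vecMulVec, dotProduct_comm, hvv, smul_eq_mul, inv_mul_cancel₀ hj,
      sub_self]
  exact ⟨_, v, sub_eq_zero.mp hE⟩

lemma IsPureState.mul_mul_self {n : Type*} [Fintype n] {W : Matrix n n ℂ} (hW : IsPureState W)
    (M : Matrix n n ℂ) : W * M * W = (M * W).trace • W := by
  obtain ⟨a, v, rfl⟩ := hW.eq_vecMulVec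
  have h : vecMulVec v (star v) * M * vecMulVec v (star v) =
      (M * vecMulVec v (star v)).trace • vecMulVec v (star v) := by
    rw [vecMulVec_mul, vecMulVec_mul_vecMulVec, ← dotProduct_mulVec, vecMulVec_smul, mul_vecMulVec,
      trace_vecMulVec, dotProduct_comm]
  rw [Matrix.smul_mul, Matrix.smul_mul, Matrix.mul_smul, Matrix.mul_smul, h, trace_smul, smul_smul,
    smul_smul, smul_smul, smul_eq_mul, mul_right_comm, mul_assoc]

section Spectral

variable {n : Type*} [Fintype n] [DecidableEq n]

lemma isHermitian_one_sub_projNonneg (A : Matrix n n ℂ) : (1 - projNonneg A).IsHermitian := by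
  refine isHermitian_one.sub ?_
  unfold projNonneg
  split_ifs with hA
  · refine isHermitian_mul_mul_conjTranspose _ ?_
    refine isHermitian_diagonal_of_self_adjoint _ ?_
    ext i
    by_cases h : 0 ≤ hA.eigenvalues i <;> simp [h]
  · exact isHermitian_zero

lemma Matrix.IsHermitian.one_sub_projNonneg_eq {A : Matrix n n ℂ} (hA : A.IsHermitian) :
    1 - projNonneg A = (hA.eigenvectorUnitary : Matrix n n ℂ) *
      diagonal (fun i => if 0 ≤ hA.eigenvalues i then (0 : ℂ) else 1) *
      star (hA.eigenvectorUnitary : Matrix n n ℂ) := by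
  have h1 : (1 : Matrix n n ℂ) = (hA.eigenvectorUnitary : Matrix n n ℂ) * 1 *
      star (hA.eigenvectorUnitary : Matrix n n ℂ) := by simp
  rw [projNonneg, dif_pos hA]
  nth_rw 1 [h1]
  rw [← sub_mul, ← mul_sub, ← diagonal_one, diagonal_sub]
  congr 3
  ext i
  split_ifs <;> simp

lemma unitary_conj_mul (U : unitaryGroup n ℂ) (D E : Matrix n n ℂ) :
    ((U : Matrix n n ℂ) * D * star (U : Matrix n n ℂ)) *
      ((U : Matrix n n ℂ) * E * star (U : Matrix n n ℂ)) =
      (U : Matrix n n ℂ) * (D * E) * star (U : Matrix n n ℂ) := by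
  have h : star (U : Matrix n n ℂ) * (U : Matrix n n ℂ) = 1 := by simp
  calc _ = (U : Matrix n n ℂ) * D * (star (U : Matrix n n ℂ) * (U : Matrix n n ℂ)) * E *
        star (U : Matrix n n ℂ) := by simp only [mul_assoc]
    _ = _ := by rw [h]; simp only [mul_assoc, one_mul]

lemma Matrix.IsHermitian.one_sub_projNonneg_mul_self {A : Matrix n n ℂ} (hA : A.IsHermitian) :
    (1 - projNonneg A) * (1 - projNonneg A) = 1 - projNonneg A := by
  rw [hA.one_sub_projNonneg_eq, unitary_conj_mul, diagonal_mul_diagonal]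
  congr 3
  ext i
  split_ifs <;> simp

lemma Matrix.IsHermitian.posSemidef_neg_compression {A : Matrix n n ℂ} (hA : A.IsHermitian) :
    (-((1 - projNonneg A) * A * (1 - projNonneg A))).PosSemidef := by
  have hs : A = (hA.eigenvectorUnitary : Matrix n n ℂ) *
      diagonal (RCLike.ofReal ∘ hA.eigenvalues) * star (hA.eigenvectorUnitary : Matrix n n ℂ) := by
    conv_lhs => rw [hA.spectral_theorem]
    rw [Unitary.conjStarAlgAut_apply]
  have key : -((1 - projNonneg A) * A * (1 - projNonneg A)) =
      (hA.eigenvectorUnitary : Matrix n n ℂ) *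
        diagonal (fun i => ((if 0 ≤ hA.eigenvalues i then 0 else -hA.eigenvalues i : ℝ) : ℂ)) *
        star (hA.eigenvectorUnitary : Matrix n n ℂ) := by
    rw [hA.one_sub_projNonneg_eq]
    conv_lhs =>
      enter [1, 1, 2]
      rw [hs]
    rw [unitary_conj_mul, unitary_conj_mul, diagonal_mul_diagonal, diagonal_mul_diagonal,
      ← neg_mul, ← mul_neg, diagonal_neg]
    congr 3
    ext i
    by_cases h : 0 ≤ hA.eigenvalues i <;> simp [h]
  rw [key]
  refine PosSemidef.mul_mul_conjTranspose_same (.diagonal fun i => ?_) _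
  split_ifs with h
  · simp
  · exact Complex.zero_le_real.mpr (by linarith)

/-- The rank-one test `T W T / tr (T W)`, with `T` the projection onto the negative part of
`ρ - e`, accepts `W` with probability `tr (T W)` and `ρ` with probability at most `e`. -/
lemma IsPureState.exists_test {W : Matrix n n ℂ} (hW : IsPureState W) {ρ : Matrix n n ℂ} {e : ℝ}
    (he : 0 ≤ e) (hA : (ρ - e • (1 : Matrix n n ℂ)).IsHermitian) :
    ∃ Q : Matrix n n ℂ, Q.PosSemidef ∧ (1 - Q).PosSemidef ∧
      (Q * W).trace.re = ((1 - projNonneg (ρ - e • (1 : Matrix n n ℂ))) * W).trace.re ∧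
      (Q * ρ).trace.re ≤ e := by
  have hTH := isHermitian_one_sub_projNonneg (ρ - e • (1 : Matrix n n ℂ))
  have hTT := hA.one_sub_projNonneg_mul_self
  have hneg := hA.posSemidef_neg_compression
  set T := 1 - projNonneg (ρ - e • (1 : Matrix n n ℂ))
  have hWpos := PosSemidef.of_isHermitian_of_mul_self hW.1 hW.2.1
  obtain ⟨c, hc0, hc⟩ : ∃ c : ℝ, 0 ≤ c ∧ (T * W).trace = c := by
    have h := (hWpos.mul_mul_conjTranspose_same T).trace_nonneg
    rw [hTH.eq, trace_mul_comm, ← mul_assoc, hTT, Complex.nonneg_iff] at h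
    exact ⟨_, h.1, Complex.ext rfl h.2.symm⟩
  have hWTW : W * T * W = (c : ℂ) • W := by rw [hW.mul_mul_self, hc]
  have hcc : ((c⁻¹ : ℝ) : ℂ) * (((c⁻¹ : ℝ) : ℂ) * c) = ((c⁻¹ : ℝ) : ℂ) := by
    norm_cast
    rcases eq_or_ne c 0 with h | h <;> simp [h]
  have hcc' : ((c⁻¹ : ℝ) : ℂ) * (c * c) = c := by
    norm_cast
    rcases eq_or_ne c 0 with h | h <;> simp [h]
  have hQpos : (((c⁻¹ : ℝ) : ℂ) • (T * W * T)).PosSemidef := by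
    have h := hWpos.mul_mul_conjTranspose_same T
    rw [hTH.eq] at h
    exact h.smul (Complex.zero_le_real.mpr (inv_nonneg.mpr hc0))
  have hQQ : (((c⁻¹ : ℝ) : ℂ) • (T * W * T)) * (((c⁻¹ : ℝ) : ℂ) • (T * W * T)) =
      ((c⁻¹ : ℝ) : ℂ) • (T * W * T) := by
    have h : T * W * T * (T * W * T) = (c : ℂ) • (T * W * T) := by
      calc T * W * T * (T * W * T) = T * (W * (T * T) * W) * T := by simp only [mul_assoc]
        _ = _ := by rw [hTT, hWTW]; simp
    rw [Matrix.smul_mul, Matrix.mul_smul, h, smul_smul, smul_smul, mul_assoc, hcc]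
  refine ⟨((c⁻¹ : ℝ) : ℂ) • (T * W * T), hQpos, ?_, ?_, ?_⟩
  · refine .of_isHermitian_of_mul_self (isHermitian_one.sub hQpos.isHermitian) ?_
    simp only [sub_mul, mul_sub, one_mul, mul_one, hQQ]
    abel
  · have h : (T * W * T * W).trace = (c : ℂ) * c := by
      rw [mul_assoc, mul_assoc, ← mul_assoc W, hWTW, Matrix.mul_smul, trace_smul, hc, smul_eq_mul]
    rw [Matrix.smul_mul, trace_smul, h, smul_eq_mul, hcc', hc]
  · have h1 := hneg.re_trace_mul_nonneg_of_mul_self hW.1 hW.2.1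
    have h2 : (T * W * T * ρ).trace = (T * ρ * T * W).trace := by
      rw [mul_assoc (T * W), trace_mul_comm, ← mul_assoc]
    have h3 : T * (ρ - e • (1 : Matrix n n ℂ)) * T = T * ρ * T - (e : ℂ) • T := by
      rw [mul_sub T, sub_mul _ _ T, Matrix.mul_smul, mul_one, Matrix.smul_mul, hTT]
      rfl
    rw [h3, neg_sub, sub_mul, trace_sub, Matrix.smul_mul, trace_smul, hc, ← h2] at h1
    rw [Matrix.smul_mul, trace_smul, smul_eq_mul, Complex.re_ofReal_mul]
    have h4 : (T * W * T * ρ).trace.re ≤ e * c := by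
      simpa using h1
    calc c⁻¹ * (T * W * T * ρ).trace.re ≤ c⁻¹ * (e * c) :=
          mul_le_mul_of_nonneg_left h4 (inv_nonneg.mpr hc0)
      _ ≤ e := by
        rcases eq_or_ne c 0 with h | h
        · simpa [h] using he
        · rw [mul_comm e, inv_mul_cancel_left₀ h]

end Spectral

lemma isHermitian_WPavg {X : Type*} [Fintype X] {n : Type*} [Fintype n] (P : X → ℝ)
    {W : X → Matrix n n ℂ} (hW : ∀ x, (W x).IsHermitian) : (WPavg P W).IsHermitian := by
  simp only [IsHermitian, WPavg, conjTranspose_sum, conjTranspose_smul, (hW _).eq]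
  simp

lemma trace_WPavg {X : Type*} [Fintype X] {n : Type*} [Fintype n] {P : X → ℝ}
    {W : X → Matrix n n ℂ} (hW : ∀ x, (W x).trace = 1) (hP1 : ∑ x, P x = 1) :
    (WPavg P W).trace = 1 := by
  simp only [WPavg, trace_sum, trace_smul, hW, smul_eq_mul, mul_one]
  exact_mod_cast hP1

/-- A test accepting `R[P]` with positive probability accepts `S[P, W_P]` with probability
bounded below. -/
lemma sq_div_card_le_trace_mul_Scq {X : Type*} [Fintype X] [DecidableEq X] {n : Type*} [Fintype n]
    [DecidableEq n] {W : X → Matrix n n ℂ} (hW : ∀ x, IsPureState (W x)) {P : X → ℝ}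
    (hP0 : ∀ x, 0 ≤ P x) {Q : Matrix (X × n) (X × n) ℂ} (hQ : Q.PosSemidef)
    (hQ1 : (1 - Q).PosSemidef) :
    (Q * Rcq P W).trace.re ^ 2 / Fintype.card X ≤ (Q * Scq P (WPavg P W)).trace.re := by
  rw [trace_mul_Rcq, trace_mul_Scq]
  have hQx : ∀ x, (Q.submatrix (Prod.mk x) (Prod.mk x)).PosSemidef := fun x => hQ.submatrix _
  have hnn : ∀ x y, 0 ≤ (Q.submatrix (Prod.mk x) (Prod.mk x) * W y).trace.re := fun x y =>
    (hQx x).re_trace_mul_nonneg_of_mul_self (hW y).1 (hW y).2.1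
  have hle : ∀ x, (Q.submatrix (Prod.mk x) (Prod.mk x) * W x).trace.re ≤ 1 := fun x => by
    have h := (hQ1.submatrix (Prod.mk x)).re_trace_mul_nonneg_of_mul_self (hW x).1 (hW x).2.1
    have h1 : (1 - Q).submatrix (Prod.mk x) (Prod.mk x) =
        1 - Q.submatrix (Prod.mk x) (Prod.mk x) := by
      ext i j
      simp [one_apply]
    rw [h1, sub_mul, one_mul, trace_sub, (hW x).2.2] at h
    simpa using h
  refine div_le_of_le_mul₀ (Nat.cast_nonneg _) (Finset.sum_nonneg fun x _ => ?_) ?_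
  · rw [re_trace_mul_WPavg]
    exact mul_nonneg (hP0 x) (Finset.sum_nonneg fun y _ => mul_nonneg (hP0 y) (hnn x y))
  refine sq_sum_le_card_mul_sum_sq.trans ?_
  rw [mul_comm, Finset.card_univ]
  refine mul_le_mul_of_nonneg_right (Finset.sum_le_sum fun x _ => ?_) (Nat.cast_nonneg _)
  rw [re_trace_mul_WPavg]
  have h : P x * (Q.submatrix (Prod.mk x) (Prod.mk x) * W x).trace.re ≤
      ∑ y, P y * (Q.submatrix (Prod.mk x) (Prod.mk x) * W y).trace.re :=
    Finset.single_le_sum (f := fun y => P y * (Q.submatrix (Prod.mk x) (Prod.mk x) * W y).trace.re)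
      (fun y _ => mul_nonneg (hP0 y) (hnn x y)) (Finset.mem_univ x)
  refine le_trans ?_ (mul_le_mul_of_nonneg_left h (hP0 x))
  have hsq : (Q.submatrix (Prod.mk x) (Prod.mk x) * W x).trace.re ^ 2 ≤
      (Q.submatrix (Prod.mk x) (Prod.mk x) * W x).trace.re := by
    nlinarith [hnn x x, hle x]
  rw [mul_pow, ← mul_assoc, ← sq]
  exact mul_le_mul_of_nonneg_left hsq (sq_nonneg _)

/-- for a pure-state cq-channel and a distribution `P`,
`D_H^ε(R[P] ‖ S[P, W_P]) ≥ H_s^ε(W_P)` for every `ε ∈ (0,1)`. -/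
theorem statement_0 {X : Type} [Fintype X] [DecidableEq X] {d : ℕ}
    (W : X → Matrix (Fin d) (Fin d) ℂ) (hW : ∀ x, IsPureState (W x))
    (P : X → ℝ) (hP0 : ∀ x, 0 ≤ P x) (hP1 : ∑ x, P x = 1)
    (ε : ℝ) (hε : ε ∈ Set.Ioo (0 : ℝ) 1) :
    Hs ε (WPavg P W) ≤ DH ε (Rcq P W) (Scq P (WPavg P W)) := by
  obtain ⟨hε0, hε1⟩ := hε
  have hX : 0 < Fintype.card X := by
    rw [Fintype.card_pos_iff]
    by_contra h
    rw [not_nonempty_iff] at h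
    simp at hP1
  have hlow : ∀ Q : Matrix (X × Fin d) (X × Fin d) ℂ, Q.PosSemidef → (1 - Q).PosSemidef →
      1 - ε ≤ (Q * Rcq P W).trace.re →
      (1 - ε) ^ 2 / Fintype.card X ≤ (Q * Scq P (WPavg P W)).trace.re := fun Q hQ hQ1 hQR => by
    refine le_trans ?_ (sq_div_card_le_trace_mul_Scq hW hP0 hQ hQ1)
    have : 0 ≤ 1 - ε := by linarith
    gcongr
  have hone : (1 : Matrix (X × Fin d) (X × Fin d) ℂ).PosSemidef ∧
      (1 - (1 : Matrix (X × Fin d) (X × Fin d) ℂ)).PosSemidef ∧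
      1 - ε ≤ ((1 : Matrix (X × Fin d) (X × Fin d) ℂ) * Rcq P W).trace.re ∧
      1 = ((1 : Matrix (X × Fin d) (X × Fin d) ℂ) * Scq P (WPavg P W)).trace.re := by
    refine ⟨.one, by simpa using PosSemidef.zero, ?_, ?_⟩
    · rw [trace_mul_Rcq]
      simp only [submatrix_one _ (Prod.mk_right_injective _), one_mul, (hW _).2.2, Complex.one_re,
        mul_one, hP1]
      linarith
    · rw [trace_mul_Scq]
      simp [submatrix_one _ (Prod.mk_right_injective _), trace_WPavg (fun x => (hW x).2.2) hP1, hP1]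
  unfold Hs DH
  set S := {t : ℝ | ∃ Q : Matrix (X × Fin d) (X × Fin d) ℂ,
      Q.PosSemidef ∧ ((1 : Matrix (X × Fin d) (X × Fin d) ℂ) - Q).PosSemidef ∧
      1 - ε ≤ ((Q * Rcq P W).trace).re ∧ t = ((Q * Scq P (WPavg P W)).trace).re}
  have hmem : (1 : ℝ) ∈ S := ⟨1, hone⟩
  have hbound : ∀ t ∈ S, (1 - ε) ^ 2 / Fintype.card X ≤ t := by
    rintro t ⟨Q, hQ, hQ1, hQR, rfl⟩
    exact hlow Q hQ hQ1 hQR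
  have hpos : 0 < sInf S := by
    have h1 : 0 < 1 - ε := by linarith
    have h2 : (0 : ℝ) < (1 - ε) ^ 2 / Fintype.card X := by positivity
    exact h2.trans_le (le_csInf ⟨1, hmem⟩ hbound)
  have hbdd : BddBelow S := ⟨_, hbound⟩
  refine Real.sSup_le (fun lam hlam => ?_) ?_
  · have he : 0 ≤ Real.exp (-lam) := (Real.exp_pos _).le
    have hA : (WPavg P W - Real.exp (-lam) • (1 : Matrix (Fin d) (Fin d) ℂ)).IsHermitian := by
      refine (isHermitian_WPavg P fun x => (hW x).1).sub ?_
      rw [IsHermitian, conjTranspose_smul, conjTranspose_one, star_trivial]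
    choose Q hQ hQ1 hQW hQρ using fun x => (hW x).exists_test he hA
    have hR : 1 - ε ≤ (blockSum Q * Rcq P W).trace.re := by
      rw [trace_mul_Rcq]
      simp only [submatrix_blockSum, hQW]
      rw [← re_trace_mul_WPavg, sub_mul, one_mul, trace_sub, trace_WPavg (fun x => (hW x).2.2) hP1,
        trace_mul_comm]
      have h : (WPavg P W * projNonneg
          (WPavg P W - Real.exp (-lam) • (1 : Matrix (Fin d) (Fin d) ℂ))).trace.re ≤ ε := hlam
      rw [Complex.sub_re, Complex.one_re]
      linarith
    have hle : (blockSum Q * Scq P (WPavg P W)).trace.re ≤ Real.exp (-lam) := by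
      rw [trace_mul_Scq]
      simp only [submatrix_blockSum]
      calc ∑ x, P x * (Q x * WPavg P W).trace.re ≤ ∑ x, P x * Real.exp (-lam) :=
            Finset.sum_le_sum fun x _ => mul_le_mul_of_nonneg_left (hQρ x) (hP0 x)
        _ = Real.exp (-lam) := by rw [← Finset.sum_mul, hP1, one_mul]
    have hS' : (blockSum Q * Scq P (WPavg P W)).trace.re ∈ S :=
      ⟨_, posSemidef_blockSum hQ, one_sub_blockSum Q ▸ posSemidef_blockSum hQ1, hR, rfl⟩
    have := (Real.log_le_iff_le_exp hpos).mpr ((csInf_le hbdd hS').trans hle)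
    linarith
  · exact neg_nonneg.mpr (Real.log_nonpos hpos.le (csInf_le hbdd hmem))
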